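/- Let q ≥ 3, β > 0 and h ≥ 0 with (β,h) ≠ (β_0,h_0), and let x_s ∈ ℝ^q be a global minimum point of G_{β,h}, with coordinates written so that x_{s,1} ≥ x_{s,2} = ⋯ = x_{s,q} > 0. Then β x_{s,q} < 1 and β q x_{s,1} x_{s,q} < 1; in particular β ∉ {1/x_{s,q}, 1/(q x_{s,1} x_{s,q})}, and the Hessian matrix D²G_{β,h}(x_s) is positive definite. -/

import Mathlib

open Finset

noncomputable section

namespace CWP

/-- The function G_{β,h}. -/
def G (q : ℕ) [NeZero q] (β h : ℝ) (u : Fin q → ℝ) : ℝ :=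
  β / 2 * (∑ i, u i ^ 2) -
    Real.log (∑ k, Real.exp (β * u k + if k = 0 then h else 0))

/-- The Hessian matrix of G_{β,h} at x, given by the second partial derivatives. -/
def hessG (q : ℕ) [NeZero q] (β h : ℝ) (x : Fin q → ℝ) : Matrix (Fin q) (Fin q) ℝ :=
  Matrix.of fun i j =>
    fderiv ℝ (fun u => fderiv ℝ (G q β h) u (Pi.single j 1)) x (Pi.single i 1)


/-- p is the logistic function. -/
lemma one_dim_aux (a c δ : ℝ) (ha : 0 < a) (ha1 : a < 1) (hδ : 0 < δ)
    (hp : ∀ s, 0 < s → s < δ → c < (a * Real.exp s / (1 - a + a * Real.exp s)) *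
       (1 - a * Real.exp s / (1 - a + a * Real.exp s))) :
    c / 2 * δ ^ 2 + a * δ - Real.log (1 - a + a * Real.exp δ) < 0 := by
  have hZ : ∀ s, 0 < 1 - a + a * Real.exp s := fun s => by
    have := mul_pos ha (Real.exp_pos s); linarith
  have hE : ∀ s, HasDerivAt (fun s => 1 - a + a * Real.exp s) (a * Real.exp s) s := fun s =>
    ((Real.hasDerivAt_exp s).const_mul a).const_add (1 - a)
  have hf : ∀ s, HasDerivAt (fun s => c / 2 * s ^ 2 + a * s - Real.log (1 - a + a * Real.exp s))
      (c * s + a - a * Real.exp s / (1 - a + a * Real.exp s)) s := fun s => by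
    have h1 := (((hasDerivAt_pow 2 s).const_mul (c / 2)).add ((hasDerivAt_id s).const_mul a)).sub
      ((hE s).log (hZ s).ne')
    refine h1.congr_deriv ?_
    simp; ring
  have hf' : ∀ s, HasDerivAt (fun s => c * s + a - a * Real.exp s / (1 - a + a * Real.exp s))
      (c - (a * Real.exp s / (1 - a + a * Real.exp s)) *
       (1 - a * Real.exp s / (1 - a + a * Real.exp s))) s := fun s => by
    have h1 := (((hasDerivAt_id s).const_mul c).add_const a).sub
      (((Real.hasDerivAt_exp s).const_mul a).div (hE s) (hZ s).ne')
    refine h1.congr_deriv ?_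
    have := (hZ s).ne'
    field_simp
  have A' : StrictAntiOn (fun s => c * s + a - a * Real.exp s / (1 - a + a * Real.exp s))
      (Set.Icc 0 δ) := by
    apply strictAntiOn_of_deriv_neg (convex_Icc 0 δ)
    · exact fun s _ => (hf' s).continuousAt.continuousWithinAt
    · intro s hs
      rw [interior_Icc] at hs
      rw [(hf' s).deriv]
      have := hp s hs.1 hs.2
      linarith
  have A : StrictAntiOn (fun s => c / 2 * s ^ 2 + a * s - Real.log (1 - a + a * Real.exp s))
      (Set.Icc 0 δ) := by
    apply strictAntiOn_of_deriv_neg (convex_Icc 0 δ)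
    · exact fun s _ => (hf s).continuousAt.continuousWithinAt
    · intro s hs
      rw [interior_Icc] at hs
      rw [(hf s).deriv]
      have := A' (Set.left_mem_Icc.2 hδ.le) ⟨hs.1.le, hs.2.le⟩ hs.1
      simpa using this
  have := A (Set.left_mem_Icc.2 hδ.le) (Set.right_mem_Icc.2 hδ.le) hδ
  simpa using this

lemma one_dim_half (a c : ℝ) (ha : 0 < a) (ha1 : a ≤ 1 / 2)
    (hc : c ≤ a * (1 - a)) (hne : a = 1 / 2 → c < a * (1 - a)) :
    ∃ s : ℝ, c / 2 * s ^ 2 + a * s - Real.log (1 - a + a * Real.exp s) < 0 := by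
  have hZ : ∀ s, 0 < 1 - a + a * Real.exp s := fun s => by
    have := mul_pos ha (Real.exp_pos s); linarith
  have hcont : Continuous (fun s => a * Real.exp s / (1 - a + a * Real.exp s)) :=
    Continuous.div (by fun_prop) (by fun_prop) (fun s => (hZ s).ne')
  have key : ∃ δ > 0, ∀ s, 0 < s → s < δ → c < (a * Real.exp s / (1 - a + a * Real.exp s)) *
       (1 - a * Real.exp s / (1 - a + a * Real.exp s)) := by
    rcases ha1.lt_or_eq with h | h
    · have : ∀ᶠ s in nhds (0:ℝ), a * Real.exp s / (1 - a + a * Real.exp s) < 1 / 2 := by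
        apply hcont.continuousAt.eventually_lt continuousAt_const
        simpa using h
      obtain ⟨δ, hδ, H⟩ := Metric.eventually_nhds_iff.1 this
      refine ⟨δ, hδ, fun s h0 h1 => ?_⟩
      have h2 := H (y := s) (by rw [Real.dist_eq, sub_zero, abs_of_pos h0]; exact h1)
      have h3 : a < a * Real.exp s / (1 - a + a * Real.exp s) := by
        rw [lt_div_iff₀ (hZ s)]
        have : 1 < Real.exp s := by simpa using h0
        nlinarith [mul_pos (mul_pos ha (by linarith : 0 < 1 - a)) (sub_pos.2 this)]
      generalize a * Real.exp s / (1 - a + a * Real.exp s) = p at *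
      nlinarith
    · have : ∀ᶠ s in nhds (0:ℝ), c < (a * Real.exp s / (1 - a + a * Real.exp s)) *
       (1 - a * Real.exp s / (1 - a + a * Real.exp s)) := by
        apply continuousAt_const.eventually_lt (hcont.mul (continuous_const.sub hcont)).continuousAt
        simpa using hne h
      obtain ⟨δ, hδ, H⟩ := Metric.eventually_nhds_iff.1 this
      refine ⟨δ, hδ, fun s h0 h1 => ?_⟩
      exact H (y := s) (by rw [Real.dist_eq, sub_zero, abs_of_pos h0]; exact h1)
  obtain ⟨δ, hδ, H⟩ := key
  exact ⟨δ, one_dim_aux a c δ ha (by linarith) hδ H⟩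

lemma one_dim (a c : ℝ) (ha : 0 < a) (ha1 : a < 1)
    (hc : c ≤ a * (1 - a)) (hne : a = 1 / 2 → c < a * (1 - a)) :
    ∃ s : ℝ, c / 2 * s ^ 2 + a * s - Real.log (1 - a + a * Real.exp s) < 0 := by
  rcases le_total a (1 / 2) with h | h
  · exact one_dim_half a c ha h hc hne
  · obtain ⟨s, hs⟩ := one_dim_half (1 - a) c (by linarith) (by linarith) (by linarith)
      (fun h => by have := hne (by linarith); linarith)
    refine ⟨-s, ?_⟩
    have e : 1 - (1 - a) + (1 - a) * Real.exp s
        = Real.exp s * (1 - a + a * Real.exp (-s)) := by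
      rw [Real.exp_neg]; field_simp; ring
    have hZ : 0 < 1 - a + a * Real.exp (-s) := by
      have := mul_pos ha (Real.exp_pos (-s)); linarith
    rw [e, Real.log_mul (Real.exp_pos s).ne' hZ.ne', Real.log_exp] at hs
    nlinarith

/-- The Gibbs weights. -/
def pw (q : ℕ) [NeZero q] (β h : ℝ) (u : Fin q → ℝ) (j : Fin q) : ℝ :=
  Real.exp (β * u j + if j = 0 then h else 0) /
    ∑ k, Real.exp (β * u k + if k = 0 then h else 0)

lemma Z_pos (q : ℕ) [NeZero q] (β h : ℝ) (u : Fin q → ℝ) :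
    0 < ∑ k, Real.exp (β * u k + if k = 0 then h else 0) :=
  Finset.sum_pos (fun _ _ => Real.exp_pos _) ⟨0, Finset.mem_univ _⟩

lemma hasFDerivAt_e (q : ℕ) [NeZero q] (β h : ℝ) (u : Fin q → ℝ) (k : Fin q) :
    HasFDerivAt (fun u : Fin q → ℝ => Real.exp (β * u k + if k = 0 then h else 0))
      (Real.exp (β * u k + if k = 0 then h else 0) •
        (β • (ContinuousLinearMap.proj k : (Fin q → ℝ) →L[ℝ] ℝ))) u := by
  have h1 : HasFDerivAt (fun u : Fin q → ℝ => u k)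
    (ContinuousLinearMap.proj k : (Fin q → ℝ) →L[ℝ] ℝ) u := hasFDerivAt_apply k u
  exact ((h1.const_mul β).add_const _).exp

lemma hasFDerivAt_Z (q : ℕ) [NeZero q] (β h : ℝ) (u : Fin q → ℝ) :
    HasFDerivAt (fun u : Fin q → ℝ => ∑ k, Real.exp (β * u k + if k = 0 then h else 0))
      (∑ k, Real.exp (β * u k + if k = 0 then h else 0) •
        (β • (ContinuousLinearMap.proj k : (Fin q → ℝ) →L[ℝ] ℝ))) u :=
  HasFDerivAt.fun_sum fun k _ => hasFDerivAt_e q β h u k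

lemma hasFDerivAt_G (q : ℕ) [NeZero q] (β h : ℝ) (u : Fin q → ℝ) :
    HasFDerivAt (G q β h) (∑ k, (β * u k - β * pw q β h u k) •
        (ContinuousLinearMap.proj k : (Fin q → ℝ) →L[ℝ] ℝ)) u := by
  have h1 : HasFDerivAt (fun u : Fin q → ℝ => ∑ i, u i ^ 2)
      (∑ i, (2 * u i) • (ContinuousLinearMap.proj i : (Fin q → ℝ) →L[ℝ] ℝ)) u := by
    refine HasFDerivAt.fun_sum fun k _ => ?_
    have h1 : HasFDerivAt (fun u : Fin q → ℝ => u k)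
      (ContinuousLinearMap.proj k : (Fin q → ℝ) →L[ℝ] ℝ) u := hasFDerivAt_apply k u
    have := h1.pow 2
    refine this.congr_fderiv ?_
    ext v; simp
  have h2 := (h1.const_mul (β / 2)).sub ((hasFDerivAt_Z q β h u).log (Z_pos q β h u).ne')
  refine h2.congr_fderiv ?_
  ext v
  simp only [ContinuousLinearMap.sub_apply, ContinuousLinearMap.smul_apply,
    ContinuousLinearMap.sum_apply, ContinuousLinearMap.proj_apply, smul_eq_mul, Finset.mul_sum,
    ← Finset.sum_sub_distrib, pw]
  refine Finset.sum_congr rfl fun k _ => ?_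
  ring

lemma fderiv_G_single (q : ℕ) [NeZero q] (β h : ℝ) (u : Fin q → ℝ) (j : Fin q) :
    fderiv ℝ (G q β h) u (Pi.single j 1) = β * u j - β * pw q β h u j := by
  rw [(hasFDerivAt_G q β h u).fderiv]
  simp [Pi.single_apply]

lemma hessG_apply (q : ℕ) [NeZero q] (β h : ℝ) (u : Fin q → ℝ) (i j : Fin q) :
    hessG q β h u i j = (if i = j then β - β ^ 2 * pw q β h u j else 0)
      + β ^ 2 * (pw q β h u i * pw q β h u j) := by
  simp only [hessG, Matrix.of_apply, fderiv_G_single]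
  have h1 : HasFDerivAt (fun u : Fin q → ℝ => u j)
    (ContinuousLinearMap.proj j : (Fin q → ℝ) →L[ℝ] ℝ) u := hasFDerivAt_apply j u
  have hZ := Z_pos q β h u
  have h2 := (h1.const_mul β).sub
    (((hasFDerivAt_e q β h u j).mul ((hasDerivAt_inv hZ.ne').comp_hasFDerivAt u (hasFDerivAt_Z q β h u))).const_mul β)
  have h3 : (fun u : Fin q → ℝ => β * u j - β * pw q β h u j) = 
    (fun u : Fin q → ℝ => β * u j - β * (Real.exp (β * u j + if j = 0 then h else 0) *
    (∑ k, Real.exp (β * u k + if k = 0 then h else 0))⁻¹)) := by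
    funext u; simp only [pw, div_eq_mul_inv]
  rw [h3]
  have h4 := h2.fderiv
  erw [h4]
  have hs : ∀ k, (Pi.single i (1:ℝ) : Fin q → ℝ) k = if k = i then 1 else 0 := fun k => by
    simp [Pi.single_apply]
  simp only [ContinuousLinearMap.sub_apply, ContinuousLinearMap.smul_apply,
    ContinuousLinearMap.add_apply,
    ContinuousLinearMap.sum_apply, ContinuousLinearMap.proj_apply, smul_eq_mul, hs, pw,
    mul_ite, mul_one, mul_zero, Finset.sum_ite_eq', Finset.mem_univ, if_true,
    Function.comp_apply, eq_comm (a := j) (b := i)]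
  generalize (∑ k, Real.exp (β * u k + if k = 0 then h else 0)) = Z at hZ ⊢
  have hZ' := hZ.ne'
  clear h2 h3 h4 hs
  by_cases hij : i = j
  · subst hij
    generalize Real.exp (β * u i + if i = 0 then h else 0) = E
    simp only [if_true]
    field_simp
    ring
  · generalize Real.exp (β * u i + if i = 0 then h else 0) = E
    generalize Real.exp (β * u j + if j = 0 then h else 0) = F
    simp only [hij, if_false]
    field_simp
    ring

lemma sum_split (q : ℕ) [NeZero q] (f : Fin q → ℝ) (B : ℝ) (hf : ∀ i, i ≠ 0 → f i = B) :
    ∑ i, f i = f 0 + ((q : ℝ) - 1) * B := by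
  rw [← Finset.add_sum_erase _ _ (Finset.mem_univ (0 : Fin q)),
    Finset.sum_congr rfl (fun i hi => hf i (Finset.ne_of_mem_erase hi))]
  have : 1 ≤ q := NeZero.one_le
  simp [Finset.card_erase_of_mem, Nat.cast_sub this]

lemma quad_pos (n a b β c w S : ℝ) (hn : 0 < n) (hab : a + n * b = 1) (hβ : 0 < β)
    (h1 : β * b < 1) (h2 : β * (n + 1) * a * b < 1) (hS : w ^ 2 ≤ n * S)
    (hne : c ≠ 0 ∨ 0 < S) :
    0 < c ^ 2 + S - β * (a * c ^ 2 + b * S - (a * c + b * w) ^ 2) := by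
  obtain ⟨m, rfl⟩ : ∃ m, w = n * m := ⟨w / n, by field_simp⟩
  have hS' : n * m ^ 2 ≤ S := by
    have : n * (n * m ^ 2) ≤ n * S := by nlinarith
    exact le_of_mul_le_mul_left this hn
  have ha : a = 1 - n * b := by linarith
  have key : c ^ 2 + S - β * (a * c ^ 2 + b * S - (a * c + b * (n * m)) ^ 2)
      = (1 - β * b) * (S - n * m ^ 2) + (n / (n + 1) * (1 - β * (n + 1) * a * b) * (c - m) ^ 2
        + (c + n * m) ^ 2 / (n + 1)) := by
    subst ha; field_simp; ring
  rw [key]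
  have t1 : 0 ≤ (1 - β * b) * (S - n * m ^ 2) := mul_nonneg (by linarith) (by linarith)
  have hk : 0 < n / (n + 1) * (1 - β * (n + 1) * a * b) := mul_pos (by positivity) (by linarith)
  have t3 : 0 ≤ (c + n * m) ^ 2 / (n + 1) := by positivity
  by_cases hcm : c = m
  · subst hcm
    by_cases hc : c = 0
    · subst hc
      have : 0 < S := by simpa using hne
      have : 0 < (1 - β * b) * (S - n * 0 ^ 2) := mul_pos (by linarith) (by linarith)
      nlinarith
    · have : 0 < (c + n * c) ^ 2 / (n + 1) := by
        have : c + n * c ≠ 0 := by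
          rw [show c + n * c = c * (n + 1) by ring]; positivity
        positivity
      nlinarith
  · have : 0 < n / (n + 1) * (1 - β * (n + 1) * a * b) * (c - m) ^ 2 := 
      mul_pos hk (by have := sub_ne_zero.2 hcm; positivity)
    linarith

lemma hess_posDef (q : ℕ) [NeZero q] (hq : 3 ≤ q) (β h : ℝ) (hβ : 0 < β) (x : Fin q → ℝ)
    (a b : ℝ) (ha : pw q β h x 0 = a) (hb : ∀ i, i ≠ 0 → pw q β h x i = b)
    (hab : a + ((q : ℝ) - 1) * b = 1) (h1 : β * b < 1) (h2 : β * q * a * b < 1) :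
    (hessG q β h x).PosDef := by
  have hq' : (3 : ℝ) ≤ q := by exact_mod_cast hq
  refine Matrix.PosDef.of_dotProduct_mulVec_pos ?_ ?_
  · ext i j
    simp only [Matrix.conjTranspose_apply, hessG_apply, star_trivial]
    by_cases hij : i = j
    · subst hij; rfl
    · simp only [hij, Ne.symm hij, if_false]; ring
  · intro v hv
    have e : star v ⬝ᵥ (hessG q β h x).mulVec v
        = β * (∑ i, v i ^ 2 - β * (∑ i, pw q β h x i * v i ^ 2 - (∑ i, pw q β h x i * v i) ^ 2)) := by
      simp only [dotProduct, Matrix.mulVec, hessG_apply, star_trivial, add_mul, ite_mul, zero_mul,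
        Finset.sum_add_distrib, Finset.sum_ite_eq, Finset.mem_univ, if_true]
      rw [sq (∑ i, pw q β h x i * v i), Finset.sum_mul]
      simp only [mul_add, Finset.mul_sum, ← Finset.sum_sub_distrib, Finset.sum_add_distrib,
        mul_sub]
      simp only [Finset.sum_sub_distrib, Finset.mul_sum]
      have : ∀ A B C D E : ℝ, A = D - E → B = C → A + B = D - (E - C) := by
        intros; linarith
      apply this
      · rw [← Finset.sum_sub_distrib]
        exact Finset.sum_congr rfl fun i _ => by ring
      · exact Finset.sum_congr rfl fun i _ => Finset.sum_congr rfl fun j _ => by ring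
    rw [e]
    refine mul_pos hβ ?_
    have s0 : ∀ f : Fin q → ℝ, ∑ i, f i = f 0 + ∑ i ∈ univ.erase 0, f i := fun f =>
      (Finset.add_sum_erase _ _ (Finset.mem_univ (0 : Fin q))).symm
    have s1 : ∑ i ∈ univ.erase 0, pw q β h x i * v i ^ 2 = b * ∑ i ∈ univ.erase 0, v i ^ 2 := by
      rw [Finset.mul_sum]
      exact Finset.sum_congr rfl fun i hi => by rw [hb i (Finset.ne_of_mem_erase hi)]
    have s2 : ∑ i ∈ univ.erase 0, pw q β h x i * v i = b * ∑ i ∈ univ.erase 0, v i := by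
      rw [Finset.mul_sum]
      exact Finset.sum_congr rfl fun i hi => by rw [hb i (Finset.ne_of_mem_erase hi)]
    rw [s0 (fun i => v i ^ 2), s0 (fun i => pw q β h x i * v i ^ 2), s0 (fun i => pw q β h x i * v i),
      s1, s2, ha]
    refine quad_pos ((q : ℝ) - 1) a b β _ _ _ (by linarith) hab hβ h1 (by simpa using h2) ?_ ?_
    · have := sq_sum_le_card_mul_sum_sq (s := univ.erase (0 : Fin q)) (f := v)
      have h1q : 1 ≤ q := by omega
      simpa [Finset.card_erase_of_mem, Nat.cast_sub h1q] using this
    · by_contra! hcon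
      obtain ⟨hc0, hc1⟩ := hcon
      apply hv
      have h00 := (Finset.sum_eq_zero_iff_of_nonneg (fun i _ => sq_nonneg (v i))).1
        (le_antisymm hc1 (Finset.sum_nonneg fun i _ => sq_nonneg (v i)))
      funext i
      by_cases hi : i = 0
      · subst hi; exact hc0
      · have := h00 i (Finset.mem_erase.2 ⟨hi, Finset.mem_univ _⟩)
        simpa using this

lemma crit (q : ℕ) [NeZero q] (β h : ℝ) (hβ : 0 < β)
    (x : Fin q → ℝ) (hx : ∀ y, G q β h x ≤ G q β h y) (j : Fin q) :
    pw q β h x j = x j := by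
  have h1 : IsLocalMin (G q β h) x := Filter.Eventually.of_forall hx
  have h2 := fderiv_G_single q β h x j
  rw [h1.fderiv_eq_zero] at h2
  have h3 : β * (x j - pw q β h x j) = 0 := by rw [mul_sub, ← h2]; rfl
  rcases mul_eq_zero.1 h3 with h4 | h4
  · exact absurd h4 hβ.ne'
  · linarith

/-- G along the symmetric line through a critical point. -/
lemma G_line (q : ℕ) [NeZero q] (hq : 3 ≤ q) (β h : ℝ) (hβ : 0 < β)
    (x : Fin q → ℝ) (hx : ∀ y, G q β h x ≤ G q β h y) (b : ℝ)
    (hb : ∀ i, i ≠ 0 → x i = b) (ha0 : 0 < x 0) (ha1 : x 0 < 1)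
    (hab : x 0 + ((q : ℝ) - 1) * b = 1) (s : ℝ) :
    0 ≤ (((q : ℝ) - 1) / (q * β)) / 2 * s ^ 2 + x 0 * s
      - Real.log (1 - x 0 + x 0 * Real.exp s) := by
  have hq' : (3 : ℝ) ≤ q := by exact_mod_cast hq
  obtain ⟨t, rfl⟩ : ∃ t, s = q * β * t := ⟨s / (q * β), by field_simp⟩
  have hm := hx (fun i => if i = 0 then x 0 + ((q : ℝ) - 1) * t else b - t)
  set a := x 0 with ha
  set Z := ∑ k, Real.exp (β * x k + if k = 0 then h else 0) with hZ
  have hZp : 0 < Z := Z_pos q β h x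
  have c0 : Real.exp (β * a + h) = a * Z := by
    have := crit q β h hβ x hx 0
    rw [pw, div_eq_iff hZp.ne'] at this
    simpa using this
  have c1 : Real.exp (β * b) = b * Z := by
    have h1 : (⟨1, by omega⟩ : Fin q) ≠ 0 := by simp [Fin.ext_iff]
    have := crit q β h hβ x hx ⟨1, by omega⟩
    rw [pw, div_eq_iff hZp.ne', hb _ h1] at this
    simpa [h1] using this
  have hW : 0 < 1 - a + a * Real.exp (q * β * t) := by
    have := mul_pos ha0 (Real.exp_pos (q * β * t)); linarith
  have e1 : ∑ k : Fin q, Real.exp (β * (if k = 0 then a + ((q : ℝ) - 1) * t else b - t) +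
      if k = 0 then h else 0) = Z * (Real.exp (-(β * t)) * (1 - a + a * Real.exp (q * β * t))) := by
    rw [sum_split q _ (Real.exp (β * (b - t))) (fun i hi => by simp [hi])]
    simp only [if_true]
    have f1 : Real.exp (β * (a + ((q : ℝ) - 1) * t) + h)
        = Real.exp (β * a + h) * (Real.exp (-(β * t)) * Real.exp (q * β * t)) := by
      rw [← Real.exp_add, ← Real.exp_add]; ring_nf
    have f2 : Real.exp (β * (b - t)) = Real.exp (β * b) * Real.exp (-(β * t)) := by
      rw [← Real.exp_add]; ring_nf
    rw [f1, f2, c0, c1]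
    have : 1 - a = ((q : ℝ) - 1) * b := by linarith
    rw [this]; ring
  have e2 : ∑ k : Fin q, (if k = 0 then a + ((q : ℝ) - 1) * t else b - t) ^ 2
      = (a + ((q : ℝ) - 1) * t) ^ 2 + ((q : ℝ) - 1) * (b - t) ^ 2 := by
    rw [sum_split q _ ((b - t) ^ 2) (fun i hi => by simp [hi])]
    simp
  have e3 : ∑ k : Fin q, x k ^ 2 = a ^ 2 + ((q : ℝ) - 1) * b ^ 2 := by
    rw [sum_split q _ (b ^ 2) (fun i hi => by rw [hb i hi])]
  simp only [G] at hm
  rw [e1, e2, e3, ← hZ, Real.log_mul hZp.ne' (mul_pos (Real.exp_pos _) hW).ne',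
    Real.log_mul (Real.exp_pos _).ne' hW.ne', Real.log_exp] at hm
  have e4 : ((q : ℝ) - 1) / (q * β) / 2 * (q * β * t) ^ 2 + a * (q * β * t)
      = β / 2 * ((a + ((q : ℝ) - 1) * t) ^ 2 + ((q : ℝ) - 1) * (b - t) ^ 2)
       - β / 2 * (a ^ 2 + ((q : ℝ) - 1) * b ^ 2) + β * t := by
    have ha' : a = 1 - ((q : ℝ) - 1) * b := by linarith
    have hq0 : (q : ℝ) ≠ 0 := by positivity
    rw [ha']
    field_simp
    ring
  rw [e4]
  linarith

/-- Non-degeneracy away from (β₀,h₀): at a global minimum point x_s of G_{β,h}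
(written with x_{s,1} ≥ x_{s,2} = ⋯ = x_{s,q} > 0) one has β x_{s,q} < 1 and
β q x_{s,1} x_{s,q} < 1, so β avoids {1/x_{s,q}, 1/(q x_{s,1} x_{s,q})} and the
Hessian D²G_{β,h}(x_s) is positive definite. -/
theorem stmt_15 (q : ℕ) [NeZero q] (hq : 3 ≤ q) (β h : ℝ) (hβ : 0 < β) (hh : 0 ≤ h)
    (hne : (β, h) ≠ (4 * ((q : ℝ) - 1) / q, Real.log ((q : ℝ) - 1) - 2 * ((q : ℝ) - 2) / q))
    (x : Fin q → ℝ) (hx : ∀ y, G q β h x ≤ G q β h y)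
    (heq : ∀ i j : Fin q, i ≠ 0 → j ≠ 0 → x i = x j)
    (hle : ∀ i : Fin q, x i ≤ x 0)
    (hpos : ∀ i : Fin q, 0 < x i) :
    β * x ⟨q - 1, by omega⟩ < 1 ∧
    β * q * x 0 * x ⟨q - 1, by omega⟩ < 1 ∧
    (hessG q β h x).PosDef := by
  have hq' : (3 : ℝ) ≤ q := by exact_mod_cast hq
  have hl : (⟨q - 1, by omega⟩ : Fin q) ≠ 0 := by
    rw [Ne, Fin.ext_iff]; simp; omega
  set b := x ⟨q - 1, by omega⟩ with hbdef
  have hb : ∀ i, i ≠ 0 → x i = b := fun i hi => heq i _ hi hl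
  have hb0 : 0 < b := hpos _
  have ha0 : 0 < x 0 := hpos 0
  have hle' : b ≤ x 0 := hle _
  have hcr := crit q β h hβ x hx
  have hZp := Z_pos q β h x
  have hab : x 0 + ((q : ℝ) - 1) * b = 1 := by
    have hs : ∑ j, x j = ∑ j, pw q β h x j := Finset.sum_congr rfl (fun j _ => (hcr j).symm)
    rw [← sum_split q x b hb, hs]
    simp only [pw]
    rw [← Finset.sum_div]
    exact div_self hZp.ne'
  have ha1 : x 0 < 1 := by nlinarith
  have hline := G_line q hq β h hβ x hx b hb ha0 ha1 hab
  have hqb : 0 < (q : ℝ) * β := by positivity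
  have hlt : ((q : ℝ) - 1) / (q * β) > x 0 * (1 - x 0) := by
    by_contra hcon
    obtain ⟨s, hs⟩ := one_dim (x 0) (((q : ℝ) - 1) / (q * β)) ha0 ha1 (not_lt.1 hcon) (by
      intro ha
      refine lt_of_le_of_ne (not_lt.1 hcon) fun he => hne ?_
      have hβ0 : β = 4 * ((q : ℝ) - 1) / q := by
        rw [ha, div_eq_iff hqb.ne'] at he
        field_simp
        linarith
      have hbv : b = 1 / (2 * ((q : ℝ) - 1)) := by
        have : (q : ℝ) - 1 ≠ 0 := by linarith
        field_simp
        linarith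
      have c0 := hcr 0
      have c1 := hcr ⟨q - 1, by omega⟩
      rw [← hbdef] at c1
      rw [pw, div_eq_iff hZp.ne'] at c0 c1
      rw [if_neg hl, ← hbdef, add_zero] at c1
      rw [if_pos rfl] at c0
      have hr : Real.exp (β * x 0 + h) = ((q : ℝ) - 1) * Real.exp (β * b) := by
        rw [c0, c1, ha, hbv]
        have : (q : ℝ) - 1 ≠ 0 := by linarith
        field_simp
      have hr' := congrArg Real.log hr
      rw [Real.log_exp, Real.log_mul (by linarith) (Real.exp_pos _).ne', Real.log_exp] at hr'
      have hh0 : h = Real.log ((q : ℝ) - 1) - 2 * ((q : ℝ) - 2) / q := by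
        have : β * (x 0 - b) = 2 * ((q : ℝ) - 2) / q := by
          rw [hβ0, ha, hbv]
          have : (q : ℝ) - 1 ≠ 0 := by linarith
          field_simp
          ring
        linarith
      exact Prod.ext hβ0 hh0)
    linarith [hline s]
  have h2 : β * q * x 0 * b < 1 := by
    rw [gt_iff_lt, lt_div_iff₀ hqb, show 1 - x 0 = ((q : ℝ) - 1) * b by linarith] at hlt
    have : ((q : ℝ) - 1) * (β * q * x 0 * b) < ((q : ℝ) - 1) * 1 := by linarith
    exact lt_of_mul_lt_mul_left this (by linarith)
  have h1 : β * b < 1 := by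
    have : 1 ≤ (q : ℝ) * x 0 := by nlinarith
    have hbb : 0 < β * b := mul_pos hβ hb0
    nlinarith
  exact ⟨h1, h2, hess_posDef q hq β h hβ x (x 0) b (hcr 0) (fun i hi => (hcr i).trans (hb i hi))
    hab h1 h2⟩

end CWP
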